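/- Let W be a suitable basis of A at {β₁,…,β_I}. Let e, ẽ ∈ C[x] and M, M̃ ∈ C[x]^{r×r} be such that SW = (1/e)·MW, the gcd of e together with all entries of M equals 1, (1/ẽ)·M̃ = ((1/e)·M)^{−1}, and the gcd of ẽ together with all entries of M̃ equals 1. Let p_i ∈ C[x] be the minimal polynomial of β_i over C. Let q ∈ C[x] be nonzero, a ∈ C[x]^r and ℓ ∈ ℤ. If gcd(q, σ^j(p_i)) = 1 for all i ∈ {1,…,I} and all j ∈ ℤ, then there exist g ∈ A and c ∈ C[x]^r such that (1/σ^ℓ(q))·aW = Δg + (1/(q·e·ẽ))·cW. -/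

import Mathlib

set_option maxHeartbeats 1000000
set_option synthInstance.maxHeartbeats 200000

open Polynomial Filter

noncomputable section

namespace PRec

variable (C : Type*) [Field C] [CharZero C]

/-- The algebraic closure of the coefficient field. -/
abbrev Cbar := AlgebraicClosure C

/-- The field of formal Laurent series over the algebraic closure. -/
abbrev LS := LaurentSeries (Cbar C)

/-- The Laurent-series variable `q`. -/
def qv : LS C := HahnSeries.single 1 1

open Classical in
/-- The valuation `ν_q`, with `ν_q 0 = ⊤`, valued in the extended reals. -/
def nuq (a : LS C) : EReal := if a = 0 then ⊤ else (((a.order : ℤ) : ℝ) : EReal)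

/-- Evaluation of a rational function at the point `α + m + q`. -/
def evalAt (α : Cbar C) (m : ℤ) (p : RatFunc C) : LS C :=
  RatFunc.eval ((algebraMap (Cbar C) (LS C)).comp (algebraMap C (Cbar C)))
    (algebraMap (Cbar C) (LS C) α + (m : LS C) + qv C) p

/-- Shorthand for the canonical map `C[x] → C(x)`. -/
abbrev toRat : Polynomial C →+* RatFunc C := algebraMap (Polynomial C) (RatFunc C)

variable (ℓ : ℕ → Polynomial C) (r : ℕ)

/-- The solution space `Sol_α(L)` of `L = ℓ₀ + ℓ₁ S + ⋯ + ℓ_r S^r` at `α`,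
indexed so that `b n` stands for the value of the solution at `α + n`. -/
def SolSet (α : Cbar C) : Set (ℤ → LS C) :=
  {b | ∀ n : ℤ, ∑ i ∈ Finset.range (r + 1),
      evalAt C α n (toRat C (ℓ i)) * b (n + i) = 0}

/-- The action of an element `f = f₀ + f₁ S + ⋯ + f_{r-1} S^{r-1}` of
`A = C(x)[S]/⟨L⟩` (represented by its coefficient vector) on a sequence. -/
def elemApply (α : Cbar C) (f : Fin r → RatFunc C) (b : ℤ → LS C) : ℤ → LS C :=
  fun n => ∑ i : Fin r, evalAt C α n (f i) * b (n + (i : ℤ))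

/-- Truncated subtraction on extended reals with the convention `⊤ - ⊤ = ⊤`. -/
def esub (a b : EReal) : EReal := if b = ⊤ then ⊤ else a - b

/-- The value function `val_α` on `A`. -/
def valAt (α : Cbar C) (f : Fin r → RatFunc C) : EReal :=
  ⨅ b ∈ SolSet C ℓ r α,
    esub (nuq C (elemApply C r α f b 0))
      (Filter.liminf (fun n : ℕ => nuq C (b (-(n : ℤ)))) Filter.atTop)

/-- `f ∈ A` is (locally) integral at `α`. -/
def IntegralAt (α : Cbar C) (f : Fin r → RatFunc C) : Prop :=
  0 ≤ valAt C ℓ r α f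

/-- Membership in the local subring `C(x)_α` of rational functions having no pole at `α`. -/
def InLocalRing (α : Cbar C) (f : RatFunc C) : Prop :=
  ∃ p q : Polynomial C, (Polynomial.aeval α) q ≠ 0 ∧ f = toRat C p / toRat C q

/-- `W` is a `C(x)`-vector space basis of `A` (represented on coefficient vectors). -/
def IsVSBasis (W : Fin r → (Fin r → RatFunc C)) : Prop :=
  LinearIndependent (RatFunc C) W ∧
    Submodule.span (RatFunc C) (Set.range W) = (⊤ : Submodule (RatFunc C) (Fin r → RatFunc C))

/-- The `C(x)_α`-span of a tuple of elements of `A`. -/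
def localSpan (α : Cbar C) (W : Fin r → (Fin r → RatFunc C)) :
    Set (Fin r → RatFunc C) :=
  {f | ∃ c : Fin r → RatFunc C, (∀ i, InLocalRing C α (c i)) ∧ f = ∑ i, c i • W i}

/-- `W` is a local integral basis of `A` at `α`. -/
def IsLocalIntegralBasis (α : Cbar C) (W : Fin r → (Fin r → RatFunc C)) : Prop :=
  IsVSBasis C r W ∧ (∀ i, IntegralAt C ℓ r α (W i)) ∧
    ∀ f : Fin r → RatFunc C, IntegralAt C ℓ r α f → f ∈ localSpan C r α W

/-- The standard basis `1, S, …, S^{r-1}` of `A`. -/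
def stdBasis : Fin r → (Fin r → RatFunc C) :=
  fun i j => if j = i then 1 else 0

/-- The shift automorphism `p(x) ↦ p(x+c)` of the polynomial ring. -/
def polyShiftEquiv (c : C) : Polynomial C ≃+* Polynomial C where
  toFun p := p.comp (X + Polynomial.C c)
  invFun p := p.comp (X - Polynomial.C c)
  left_inv p := by
    show (p.comp (X + Polynomial.C c)).comp (X - Polynomial.C c) = p
    rw [Polynomial.comp_assoc]; simp
  right_inv p := by
    show (p.comp (X - Polynomial.C c)).comp (X + Polynomial.C c) = p
    rw [Polynomial.comp_assoc]; simp
  map_add' p q := by simp [Polynomial.add_comp]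
  map_mul' p q := by simp [Polynomial.mul_comp]

/-- The shift `σ^k`, `p(x) ↦ p(x+k)`, on polynomials, for `k : ℤ`. -/
def polyShift (k : ℤ) (p : Polynomial C) : Polynomial C := polyShiftEquiv C (k : C) p

/-- `σ` on polynomials. -/
def polyσ : Polynomial C ≃+* Polynomial C := polyShiftEquiv C 1

/-- The shift automorphism `σ : f(x) ↦ f(x+1)` of the rational function field. -/
def ratσ : RatFunc C →+* RatFunc C :=
  RatFunc.mapRingHom (polyσ C : Polynomial C →+* Polynomial C)
    (by
      intro p hp
      simp only [Submonoid.mem_comap]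
      refine mem_nonZeroDivisors_iff_ne_zero.mpr ?_
      have hp0 : p ≠ 0 := mem_nonZeroDivisors_iff_ne_zero.mp hp
      simpa using (map_ne_zero_iff _ (polyσ C).injective).mpr hp0)

variable [NeZero r]

/-- The index `r - 1` as an element of `Fin r`. -/
def lastIdx : Fin r := ⟨r - 1, Nat.sub_lt (Nat.pos_of_ne_zero (NeZero.ne r)) one_pos⟩

/-- The action of `S` on `A = C(x)[S]/⟨L⟩`, on coefficient vectors with respect to the
basis `1, S, …, S^{r-1}`, using `S^r = -(ℓ₀/ℓ_r) - ⋯ - (ℓ_{r-1}/ℓ_r) S^{r-1}`. -/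
def Smap (f : Fin r → RatFunc C) : Fin r → RatFunc C :=
  fun j =>
    (if (j : ℕ) = 0 then 0 else
      ratσ C (f ⟨(j : ℕ) - 1, lt_of_le_of_lt (Nat.sub_le _ _) j.isLt⟩))
      - ratσ C (f (lastIdx r)) * (toRat C (ℓ j) / toRat C (ℓ r))

/-- The difference operator `Δ = S - 1` on `A`. -/
def Dmap (f : Fin r → RatFunc C) : Fin r → RatFunc C :=
  Smap C ℓ r f - f

/-- `f ∈ A` is summable. -/
def IsSummable (f : Fin r → RatFunc C) : Prop :=
  ∃ g : Fin r → RatFunc C, f = Dmap C ℓ r g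

/-- `disp_α(p) ≥ k`: `p` has two roots in `α + ℤ` at distance `k`. -/
def DispGe (α : Cbar C) (p : Polynomial (Cbar C)) (k : ℕ) : Prop :=
  ∃ m : ℤ, Polynomial.eval (α + (m : Cbar C)) p = 0 ∧
    Polynomial.eval (α + (m : Cbar C) + (k : Cbar C)) p = 0

/-- The dispersion `disp_α(p)` as an extended natural number
(`0` by convention for the empty set, which is excluded by the hypotheses below). -/
def dispVal (α : Cbar C) (p : Polynomial (Cbar C)) : ℕ∞ :=
  sSup ((fun k : ℕ => (k : ℕ∞)) '' {k : ℕ | DispGe C α p k})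

/-- A polynomial is shift-free if it is coprime to each of its nontrivial shifts. -/
def ShiftFree {K : Type*} [Field K] [CharZero K] (p : Polynomial K) : Prop :=
  ∀ k : ℤ, k ≠ 0 → IsCoprime p (p.comp (X + Polynomial.C (k : K)))


/-- The data of the orbits `α_i + ℤ` of the roots of `ℓ₀ℓ_r`, with the minimal root
`minR i = α_{i,1}`, the maximal root `maxR i = α_{i,J_i}`, and the chosen bounds `β i`. -/
structure SuitableData (I : ℕ) where
  β : Fin I → Cbar C
  minR : Fin I → Cbar C
  maxR : Fin I → Cbar C
  minR_root : ∀ i, (Polynomial.aeval (minR i)) (ℓ 0 * ℓ r) = 0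
  maxR_root : ∀ i, (Polynomial.aeval (maxR i)) (ℓ 0 * ℓ r) = 0
  minR_le_maxR : ∀ i, ∃ m : ℕ, maxR i = minR i + (m : Cbar C)
  maxR_le_β : ∀ i, ∃ m : ℕ, β i = maxR i + (m : Cbar C)
  roots_between : ∀ i (m : ℤ), (Polynomial.aeval (minR i + (m : Cbar C))) (ℓ 0 * ℓ r) = 0 →
    0 ≤ m ∧ ∃ k : ℕ, maxR i = minR i + (m : Cbar C) + (k : Cbar C)
  orbits_distinct : ∀ i i', i ≠ i' → ∀ m : ℤ, β i ≠ β i' + (m : Cbar C)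
  orbits_cover : ∀ ξ : Cbar C, (Polynomial.aeval ξ) (ℓ 0 * ℓ r) = 0 →
    ∃ i, ∃ m : ℤ, ξ = β i + (m : Cbar C)
  conj_compat : ∀ (φ : Cbar C ≃ₐ[C] Cbar C) (i i' : Fin I), φ (maxR i) = maxR i' →
    β i - maxR i = β i' - maxR i'

/-- Membership in `Z = ⋃ᵢ {γ ∈ αᵢ + ℤ : α_{i,1} < γ ≤ βᵢ}`. -/
def memZ {I : ℕ} (D : SuitableData C ℓ r I) (γ : Cbar C) : Prop :=
  ∃ i, (∃ m : ℕ, γ + (m : Cbar C) = D.β i) ∧ (∃ k : ℕ, 1 ≤ k ∧ γ = D.minR i + (k : Cbar C))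

/-- `W` is a suitable basis of `A` at `{β₁, …, β_I}`. -/
def IsSuitableBasis {I : ℕ} (D : SuitableData C ℓ r I) (W : Fin r → (Fin r → RatFunc C)) :
    Prop :=
  IsVSBasis C r W ∧
    (∀ γ : Cbar C, memZ C ℓ r D γ → IsLocalIntegralBasis C ℓ r γ W) ∧
    (∀ γ : Cbar C, ¬ memZ C ℓ r D γ → localSpan C r γ W = localSpan C r γ (stdBasis C r))

theorem aeval_polyShift (k : ℤ) (p : Polynomial C) (γ : Cbar C) :
    aeval γ (polyShift C k p) = aeval (γ + (k : Cbar C)) p := by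
  simp [polyShift, polyShiftEquiv, aeval_comp]

theorem polyσ_eq_polyShift : (polyσ C : Polynomial C → Polynomial C) = polyShift C 1 := by
  funext p
  simp [polyσ, polyShift]

theorem aeval_polyσ (p : Polynomial C) (γ : Cbar C) :
    aeval γ (polyσ C p) = aeval (γ + 1) p := by
  simp [polyσ_eq_polyShift, aeval_polyShift]

theorem polyσ_polyShift (k : ℤ) (p : Polynomial C) :
    polyσ C (polyShift C k p) = polyShift C (k + 1) p := by
  simp only [polyσ, polyShift, polyShiftEquiv, RingEquiv.coe_mk, Equiv.coe_fn_mk, comp_assoc]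
  congr 1
  simp only [add_comp, X_comp, C_comp, Int.cast_add, Int.cast_one, map_add, map_one]
  ring

theorem ratσ_toRat (p : Polynomial C) : ratσ C (toRat C p) = toRat C (polyσ C p) := by
  rw [ratσ, RatFunc.coe_mapRingHom_eq_coe_map, ← div_one (toRat C p), ← map_one (toRat C),
    RatFunc.map_apply_div_ne_zero _ _ _ _ one_ne_zero]
  simp

theorem toRat_ne_zero {p : Polynomial C} (hp : p ≠ 0) : toRat C p ≠ 0 :=
  RatFunc.algebraMap_ne_zero hp

/-- The local ring `C(x)_α` as a subring of `C(x)`. -/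
def localSubring (α : Cbar C) : Subring (RatFunc C) where
  carrier := {f | InLocalRing C α f}
  mul_mem' := by
    rintro _ _ ⟨p, s, hs, rfl⟩ ⟨p', s', hs', rfl⟩
    exact ⟨p * p', s * s', by simp [hs, hs'], by simp [div_mul_div_comm]⟩
  one_mem' := ⟨1, 1, by simp, by simp⟩
  add_mem' := by
    rintro _ _ ⟨p, s, hs, rfl⟩ ⟨p', s', hs', rfl⟩
    refine ⟨p * s' + s * p', s * s', by simp [hs, hs'], ?_⟩
    have h : toRat C s ≠ 0 := toRat_ne_zero C (by rintro rfl; simp at hs)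
    have h' : toRat C s' ≠ 0 := toRat_ne_zero C (by rintro rfl; simp at hs')
    rw [div_add_div _ _ h h']
    simp
  zero_mem' := ⟨0, 1, by simp, by simp⟩
  neg_mem' := by
    rintro _ ⟨p, s, hs, rfl⟩
    exact ⟨-p, s, hs, by simp [neg_div]⟩

theorem mem_localSubring {α : Cbar C} {f : RatFunc C} :
    f ∈ localSubring C α ↔ InLocalRing C α f := Iff.rfl

theorem toRat_div_mem_localSubring {α : Cbar C} (p : Polynomial C) {s : Polynomial C}
    (hs : aeval α s ≠ 0) : toRat C p / toRat C s ∈ localSubring C α :=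
  ⟨p, s, hs, rfl⟩

theorem ratσ_mem_localSubring {α : Cbar C} {f : RatFunc C} (hf : f ∈ localSubring C (α + 1)) :
    ratσ C f ∈ localSubring C α := by
  obtain ⟨p, s, hs, rfl⟩ := hf
  exact ⟨polyσ C p, polyσ C s, by rwa [aeval_polyσ], by simp only [map_div₀, ratσ_toRat]⟩

theorem exists_ratσ_eq_of_mem_localSubring {α : Cbar C} {f : RatFunc C}
    (hf : f ∈ localSubring C α) : ∃ g ∈ localSubring C (α + 1), ratσ C g = f := by
  obtain ⟨p, s, hs, rfl⟩ := hf
  refine ⟨toRat C ((polyσ C).symm p) / toRat C ((polyσ C).symm s),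
    toRat_div_mem_localSubring C _ ?_, ?_⟩
  · rwa [← aeval_polyσ, RingEquiv.apply_symm_apply]
  · simp only [map_div₀, ratσ_toRat, RingEquiv.apply_symm_apply]

theorem aeval_eq_zero_of_div_mem_localSubring {α : Cbar C} {p s : Polynomial C} (hs0 : s ≠ 0)
    (hs : aeval α s = 0) (h : toRat C p / toRat C s ∈ localSubring C α) : aeval α p = 0 := by
  obtain ⟨p', s', hs', h⟩ := h
  have h0' : toRat C s' ≠ 0 := toRat_ne_zero C (by rintro rfl; simp at hs')
  rw [div_eq_div_iff (toRat_ne_zero C hs0) h0', ← map_mul, ← map_mul] at h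
  have := congrArg (aeval α) (RatFunc.algebraMap_injective C h)
  simpa [hs, hs'] using this

theorem aeval_ne_zero_of_div_mem_localSubring {ι : Type*} {α : Cbar C} {s : Polynomial C}
    {N : ι → ι → Polynomial C} (hs0 : s ≠ 0)
    (hgcd : ∀ d : Polynomial C, d ∣ s → (∀ i j, d ∣ N i j) → IsUnit d)
    (h : ∀ i j, toRat C (N i j) / toRat C s ∈ localSubring C α) : aeval α s ≠ 0 := by
  intro hs
  refine minpoly.not_isUnit C α (hgcd _ (minpoly.dvd C α hs) fun i j => minpoly.dvd C α ?_)
  exact aeval_eq_zero_of_div_mem_localSubring C hs0 hs (h i j)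

theorem mem_localSpan_stdBasis {α : Cbar C} {f : Fin r → RatFunc C} :
    f ∈ localSpan C r α (stdBasis C r) ↔ ∀ i, f i ∈ localSubring C α := by
  have key (c : Fin r → RatFunc C) : ∑ i, c i • stdBasis C r i = c := by
    funext j
    simp [Finset.sum_apply, stdBasis]
  constructor
  · rintro ⟨c, hc, rfl⟩ i
    rw [key]
    exact hc i
  · intro h
    exact ⟨f, h, (key f).symm⟩

theorem mem_localSpan_self (α : Cbar C) (W : Fin r → (Fin r → RatFunc C)) (i : Fin r) :
    W i ∈ localSpan C r α W := by
  refine ⟨Pi.single i 1, fun j => ?_, ?_⟩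
  · rw [← mem_localSubring]
    by_cases h : j = i
    · subst h
      simp
    · simp [h]
  · simp [Pi.single_apply, ite_smul]

theorem Smap_add (f g : Fin r → RatFunc C) :
    Smap C ℓ r (f + g) = Smap C ℓ r f + Smap C ℓ r g := by
  funext j
  simp only [Smap, Pi.add_apply, map_add]
  split_ifs <;> ring

theorem Smap_smul (c : RatFunc C) (f : Fin r → RatFunc C) :
    Smap C ℓ r (c • f) = ratσ C c • Smap C ℓ r f := by
  funext j
  simp only [Smap, Pi.smul_apply, smul_eq_mul, map_mul]
  split_ifs <;> ring

theorem Smap_sum {ι : Type*} (s : Finset ι) (f : ι → Fin r → RatFunc C) :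
    Smap C ℓ r (∑ i ∈ s, f i) = ∑ i ∈ s, Smap C ℓ r (f i) :=
  map_sum (⟨⟨Smap C ℓ r, by simpa using Smap_smul C ℓ r 0 0⟩, Smap_add C ℓ r⟩ :
    (Fin r → RatFunc C) →+ (Fin r → RatFunc C)) f s

theorem Dmap_add (f g : Fin r → RatFunc C) :
    Dmap C ℓ r (f + g) = Dmap C ℓ r f + Dmap C ℓ r g := by
  simp only [Dmap, Smap_add]
  abel

theorem Smap_mem_localSubring {γ : Cbar C} (hγ : aeval γ (ℓ r) ≠ 0) {f : Fin r → RatFunc C}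
    (hf : ∀ i, f i ∈ localSubring C (γ + 1)) (j : Fin r) :
    Smap C ℓ r f j ∈ localSubring C γ := by
  refine sub_mem ?_ (mul_mem (ratσ_mem_localSubring C (hf _))
    (toRat_div_mem_localSubring C _ hγ))
  split_ifs
  · exact zero_mem _
  · exact ratσ_mem_localSubring C (hf _)

theorem exists_Smap_eq_of_mem_localSubring {γ : Cbar C} (h0 : aeval γ (ℓ 0) ≠ 0)
    (hr : aeval γ (ℓ r) ≠ 0) {f : Fin r → RatFunc C} (hf : ∀ i, f i ∈ localSubring C γ) :
    ∃ g : Fin r → RatFunc C, (∀ i, g i ∈ localSubring C (γ + 1)) ∧ Smap C ℓ r g = f := by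
  have hn0 : toRat C (ℓ 0) ≠ 0 := toRat_ne_zero C (by intro h; simp [h] at h0)
  have hnr : toRat C (ℓ r) ≠ 0 := toRat_ne_zero C (by intro h; simp [h] at hr)
  have hlt : 0 < r := Nat.pos_of_ne_zero (NeZero.ne r)
  set t : RatFunc C := -(f ⟨0, hlt⟩ * (toRat C (ℓ r) / toRat C (ℓ 0))) with ht
  have htm : t ∈ localSubring C γ :=
    neg_mem (mul_mem (hf _) (toRat_div_mem_localSubring C _ h0))
  have hex (j : Fin r) : ∃ u ∈ localSubring C (γ + 1), ratσ C u =
      if h : (j : ℕ) + 1 < r then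
        f ⟨j + 1, h⟩ + t * (toRat C (ℓ (j + 1)) / toRat C (ℓ r)) else t := by
    apply exists_ratσ_eq_of_mem_localSubring
    split_ifs
    · exact add_mem (hf _) (mul_mem htm (toRat_div_mem_localSubring C _ hr))
    · exact htm
  choose g hg hσ using hex
  have hlast : ratσ C (g (lastIdx r)) = t := by
    rw [hσ, dif_neg]
    simp only [lastIdx]
    omega
  refine ⟨g, hg, ?_⟩
  funext j
  simp only [Smap, hlast]
  by_cases hj : (j : ℕ) = 0
  · obtain rfl : j = ⟨0, hlt⟩ := Fin.ext hj
    simp only [if_true, ht]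
    field_simp
    ring
  · have hj' : (j : ℕ) - 1 + 1 = j := by omega
    rw [if_neg hj, hσ, dif_pos (by simp only [hj', j.isLt])]
    simp only [hj', Fin.eta]
    ring

theorem sum_smul_sum_smul {N : Matrix (Fin r) (Fin r) (RatFunc C)}
    (W : Fin r → (Fin r → RatFunc C)) (c : Fin r → RatFunc C) :
    ∑ i, c i • ∑ j, N i j • W j = ∑ j, (∑ i, c i * N i j) • W j := by
  simp only [Finset.smul_sum, Finset.sum_smul, smul_smul]
  exact Finset.sum_comm

theorem Smap_sum_smul {W : Fin r → (Fin r → RatFunc C)}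
    {N : Matrix (Fin r) (Fin r) (RatFunc C)}
    (hSW : ∀ i, Smap C ℓ r (W i) = ∑ j, N i j • W j) (c : Fin r → RatFunc C) :
    Smap C ℓ r (∑ i, c i • W i) = ∑ j, (∑ i, ratσ C (c i) * N i j) • W j := by
  simp only [Smap_sum, Smap_smul, hSW]
  exact sum_smul_sum_smul C r W _

theorem coeff_eq_of_sum_smul_eq {W : Fin r → (Fin r → RatFunc C)}
    (hW : LinearIndependent (RatFunc C) W) {c d : Fin r → RatFunc C}
    (h : ∑ i, c i • W i = ∑ i, d i • W i) : c = d := by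
  have := Fintype.linearIndependent_iff.mp hW (fun i => c i - d i)
    (by simp [sub_smul, Finset.sum_sub_distrib, h])
  exact funext fun i => sub_eq_zero.mp (this i)

/-- The transition matrix of a basis that is locally standard at `γ` and `γ + 1`
is regular at `γ` if `ℓ_r` does not vanish there. -/
theorem transition_mem_localSubring {γ : Cbar C} (hr : aeval γ (ℓ r) ≠ 0)
    {W : Fin r → (Fin r → RatFunc C)} (hW : LinearIndependent (RatFunc C) W)
    (h₀ : localSpan C r γ W = localSpan C r γ (stdBasis C r))
    (h₁ : localSpan C r (γ + 1) W = localSpan C r (γ + 1) (stdBasis C r))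
    {N : Matrix (Fin r) (Fin r) (RatFunc C)}
    (hSW : ∀ i, Smap C ℓ r (W i) = ∑ j, N i j • W j) (i j : Fin r) :
    N i j ∈ localSubring C γ := by
  have hWi := h₁ ▸ mem_localSpan_self C r (γ + 1) W i
  have hS : Smap C ℓ r (W i) ∈ localSpan C r γ W := by
    rw [h₀, mem_localSpan_stdBasis]
    exact Smap_mem_localSubring C ℓ r hr ((mem_localSpan_stdBasis C r).mp hWi)
  obtain ⟨c, hc, hcW⟩ := hS
  rw [hSW] at hcW
  rw [coeff_eq_of_sum_smul_eq C r hW hcW]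
  exact hc j

/-- The inverse of the transition matrix of a basis that is locally standard at `γ` and `γ + 1`
is regular at `γ` if neither `ℓ₀` nor `ℓ_r` vanishes there. -/
theorem inverse_transition_mem_localSubring {γ : Cbar C} (h0 : aeval γ (ℓ 0) ≠ 0)
    (hr : aeval γ (ℓ r) ≠ 0)
    {W : Fin r → (Fin r → RatFunc C)} (hW : LinearIndependent (RatFunc C) W)
    (h₀ : localSpan C r γ W = localSpan C r γ (stdBasis C r))
    (h₁ : localSpan C r (γ + 1) W = localSpan C r (γ + 1) (stdBasis C r))
    {N N' : Matrix (Fin r) (Fin r) (RatFunc C)}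
    (hSW : ∀ i, Smap C ℓ r (W i) = ∑ j, N i j • W j) (hN : N * N' = 1) (i j : Fin r) :
    N' i j ∈ localSubring C γ := by
  have hex (i : Fin r) : ∃ c : Fin r → RatFunc C, (∀ j, c j ∈ localSubring C γ) ∧
      W i = ∑ j, (∑ l, c l * N l j) • W j := by
    have hWi := h₀ ▸ mem_localSpan_self C r γ W i
    obtain ⟨g, hg, hgS⟩ := exists_Smap_eq_of_mem_localSubring C ℓ r h0 hr
      ((mem_localSpan_stdBasis C r).mp hWi)
    rw [← mem_localSpan_stdBasis, ← h₁] at hg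
    obtain ⟨c, hc, rfl⟩ := hg
    refine ⟨fun l => ratσ C (c l), fun l => ratσ_mem_localSubring C (hc l), ?_⟩
    rw [← hgS, Smap_sum_smul C ℓ r hSW]
  choose K hK hKW using hex
  have hKN : Matrix.of K * N = 1 := by
    ext i j
    have : W i = ∑ j, (1 : Matrix (Fin r) (Fin r) (RatFunc C)) i j • W j := by
      simp [Matrix.one_apply, ite_smul]
    have h := coeff_eq_of_sum_smul_eq C r hW ((hKW i).symm.trans this)
    simpa [Matrix.mul_apply] using congrFun h j
  rw [← left_inv_eq_right_inv hKN hN]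
  exact hK i j

theorem ne_β_add_intCast_of_root {I : ℕ} (D : SuitableData C ℓ r I) {q : Polynomial C}
    (hcop : ∀ (i : Fin I) (j : ℤ), IsCoprime q (polyShift C j (minpoly C (D.β i))))
    {k : ℤ} {γ : Cbar C} (hγ : aeval γ (polyShift C k q) = 0) (i : Fin I) (m : ℤ) :
    γ ≠ D.β i + (m : Cbar C) := by
  rintro rfl
  rw [aeval_polyShift] at hγ
  obtain ⟨u, v, huv⟩ := hcop i (-(m + k))
  have h := congrArg (aeval (D.β i + (m : Cbar C) + (k : Cbar C))) huv
  have hz : D.β i + (m : Cbar C) + (k : Cbar C) + ((-(m + k) : ℤ) : Cbar C) = D.β i := by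
    push_cast
    ring
  simp [aeval_polyShift, hγ, hz, -Int.cast_neg, -Int.cast_add, -neg_add_rev] at h

theorem not_memZ_of_forall_ne {I : ℕ} (D : SuitableData C ℓ r I) {γ : Cbar C}
    (h : ∀ i (m : ℤ), γ ≠ D.β i + (m : Cbar C)) : ¬ memZ C ℓ r D γ := by
  rintro ⟨i, ⟨m, hm⟩, -⟩
  refine h i (-m) ?_
  rw [← hm]
  push_cast
  ring

/-- Away from the orbits of the roots of `ℓ₀ℓ_r`, the denominators of the transition matrix of a
suitable basis and of its inverse do not vanish. -/
theorem IsSuitableBasis.aeval_ne_zero {I : ℕ}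
    {D : SuitableData C ℓ r I} {W : Fin r → (Fin r → RatFunc C)}
    (hW : IsSuitableBasis C ℓ r D W)
    {e et : Polynomial C} {M Mt : Matrix (Fin r) (Fin r) (Polynomial C)}
    (he : e ≠ 0) (het : et ≠ 0)
    (hSW : ∀ i, Smap C ℓ r (W i) = ∑ j, (toRat C (M i j) / toRat C e) • W j)
    (hgcd : ∀ d : Polynomial C, d ∣ e → (∀ i j, d ∣ M i j) → IsUnit d)
    (hgcdt : ∀ d : Polynomial C, d ∣ et → (∀ i j, d ∣ Mt i j) → IsUnit d)
    (hinv : ((toRat C e)⁻¹ • M.map (toRat C)) * ((toRat C et)⁻¹ • Mt.map (toRat C)) = 1)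
    {γ : Cbar C} (hγ : ∀ i (m : ℤ), γ ≠ D.β i + (m : Cbar C)) :
    aeval γ e ≠ 0 ∧ aeval γ et ≠ 0 := by
  have hroot : aeval γ (ℓ 0 * ℓ r) ≠ 0 := fun h => by
    obtain ⟨i, m, h⟩ := D.orbits_cover γ h
    exact hγ i m h
  rw [map_mul] at hroot
  have h0 := left_ne_zero_of_mul hroot
  have hr := right_ne_zero_of_mul hroot
  have hγ' : ∀ i (m : ℤ), γ + 1 ≠ D.β i + (m : Cbar C) := fun i m h =>
    hγ i (m - 1) (by push_cast; linear_combination h)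
  have h₀ := hW.2.2 γ (not_memZ_of_forall_ne C ℓ r D hγ)
  have h₁ := hW.2.2 (γ + 1) (not_memZ_of_forall_ne C ℓ r D hγ')
  have hSW' : ∀ i, Smap C ℓ r (W i) = ∑ j, ((toRat C e)⁻¹ • M.map (toRat C)) i j • W j := by
    intro i
    simp only [hSW, Matrix.smul_apply, Matrix.map_apply, smul_eq_mul, div_eq_inv_mul]
  refine ⟨aeval_ne_zero_of_div_mem_localSubring C he hgcd fun i j => ?_,
    aeval_ne_zero_of_div_mem_localSubring C het hgcdt fun i j => ?_⟩
  · have := transition_mem_localSubring C ℓ r hr hW.1.1 h₀ h₁ hSW' i j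
    simpa only [Matrix.smul_apply, Matrix.map_apply, smul_eq_mul, div_eq_inv_mul] using this
  · have := inverse_transition_mem_localSubring C ℓ r h0 hr hW.1.1 h₀ h₁ hSW' hinv i j
    simpa only [Matrix.smul_apply, Matrix.map_apply, smul_eq_mul, div_eq_inv_mul] using this

/-- The element `(1/s)·aW` of `A`. -/
def fracComb (W : Fin r → (Fin r → RatFunc C)) (s : Polynomial C) (a : Fin r → Polynomial C) :
    Fin r → RatFunc C :=
  (toRat C s)⁻¹ • ∑ i, toRat C (a i) • W i

theorem fracComb_eq_sum (W : Fin r → (Fin r → RatFunc C)) (s : Polynomial C)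
    (a : Fin r → Polynomial C) :
    fracComb C r W s a = ∑ i, (toRat C (a i) / toRat C s) • W i := by
  simp only [fracComb, Finset.smul_sum, smul_smul, div_eq_inv_mul]

theorem fracComb_add (W : Fin r → (Fin r → RatFunc C)) (s : Polynomial C)
    (a b : Fin r → Polynomial C) :
    fracComb C r W s a + fracComb C r W s b = fracComb C r W s (a + b) := by
  simp [fracComb, add_smul, Finset.sum_add_distrib]

theorem fracComb_mul_left (W : Fin r → (Fin r → RatFunc C)) {s t : Polynomial C}
    (ht : t ≠ 0) (a : Fin r → Polynomial C) :
    fracComb C r W (t * s) (fun i => t * a i) = fracComb C r W s a := by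
  simp only [fracComb_eq_sum, map_mul, mul_div_mul_left _ _ (toRat_ne_zero C ht)]

theorem fracComb_partial_fractions (W : Fin r → (Fin r → RatFunc C)) {s t u v : Polynomial C}
    (hs : s ≠ 0) (ht : t ≠ 0) (h : u * s + v * t = 1) (a : Fin r → Polynomial C) :
    fracComb C r W (s * t) a =
      fracComb C r W s (fun i => v * a i) + fracComb C r W t (fun i => u * a i) := by
  simp only [fracComb_eq_sum, ← Finset.sum_add_distrib, ← add_smul]
  refine Finset.sum_congr rfl fun i _ => ?_
  congr 1
  have hs' := toRat_ne_zero C hs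
  have ht' := toRat_ne_zero C ht
  have h' := congrArg (toRat C) h
  simp only [map_add, map_mul, map_one] at h' ⊢
  field_simp
  linear_combination -toRat C (a i) * h'

theorem Smap_fracComb {W : Fin r → (Fin r → RatFunc C)} {e : Polynomial C}
    {M : Matrix (Fin r) (Fin r) (Polynomial C)}
    (hSW : ∀ i, Smap C ℓ r (W i) = ∑ j, (toRat C (M i j) / toRat C e) • W j)
    (s : Polynomial C) (a : Fin r → Polynomial C) :
    Smap C ℓ r (fracComb C r W s a) =
      fracComb C r W (polyσ C s * e) (Matrix.vecMul (fun i => polyσ C (a i)) M) := by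
  rw [fracComb_eq_sum, fracComb_eq_sum,
    Smap_sum_smul C ℓ r (N := fun i j => toRat C (M i j) / toRat C e) hSW]
  refine Finset.sum_congr rfl fun j _ => ?_
  simp only [Matrix.vecMul, dotProduct, map_sum, Finset.sum_div, map_div₀, ratσ_toRat, map_mul,
    div_mul_div_comm]

theorem statement11 [NeZero r] (hr : 1 ≤ r) (hℓ : ℓ 0 * ℓ r ≠ 0) {I : ℕ}
    (D : SuitableData C ℓ r I) (W : Fin r → (Fin r → RatFunc C))
    (hW : IsSuitableBasis C ℓ r D W)
    (e et : Polynomial C) (M Mt : Matrix (Fin r) (Fin r) (Polynomial C))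
    (he : e ≠ 0) (het : et ≠ 0)
    (hSW : ∀ i, Smap C ℓ r (W i) = ∑ j, (toRat C (M i j) / toRat C e) • W j)
    (hgcd : ∀ d : Polynomial C, d ∣ e → (∀ i j, d ∣ M i j) → IsUnit d)
    (hgcdt : ∀ d : Polynomial C, d ∣ et → (∀ i j, d ∣ Mt i j) → IsUnit d)
    (hinv : ((toRat C e)⁻¹ • M.map (toRat C)) * ((toRat C et)⁻¹ • Mt.map (toRat C)) = 1 ∧
      ((toRat C et)⁻¹ • Mt.map (toRat C)) * ((toRat C e)⁻¹ • M.map (toRat C)) = 1)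
    (q : Polynomial C) (hq : q ≠ 0) (a : Fin r → Polynomial C) (k : ℤ)
    (hcop : ∀ (i : Fin I) (j : ℤ), IsCoprime q (polyShift C j (minpoly C (D.β i)))) :
    ∃ (g : Fin r → RatFunc C) (c : Fin r → Polynomial C),
      (toRat C (polyShift C k q))⁻¹ • (∑ i, toRat C (a i) • W i)
        = Dmap C ℓ r g + (toRat C (q * e * et))⁻¹ • ∑ i, toRat C (c i) • W i := by
  have hcop_e (k : ℤ) : IsCoprime (polyShift C k q) e ∧ IsCoprime (polyShift C k q) et := by
    have key (γ : Cbar C) (hγ : aeval γ (polyShift C k q) = 0) :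
        aeval γ e ≠ 0 ∧ aeval γ et ≠ 0 :=
      hW.aeval_ne_zero C ℓ r he het hSW hgcd hgcdt hinv.1
        (ne_β_add_intCast_of_root C ℓ r D hcop hγ)
    constructor <;>
    · rw [Polynomial.isCoprime_iff_aeval_ne_zero_of_isAlgClosed C (Cbar C)]
      intro γ
      by_cases hγ : aeval γ (polyShift C k q) = 0
      · first
        | exact Or.inr (key γ hγ).1
        | exact Or.inr (key γ hγ).2
      · exact Or.inl hγ
  have hshift (k : ℤ) : polyShift C k q ≠ 0 :=
    (map_ne_zero_iff (polyShiftEquiv C (k : C)) (RingEquiv.injective _)).mpr hq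
  have hMtM : Mt * M = (et * e) • (1 : Matrix (Fin r) (Fin r) (Polynomial C)) := by
    have h := hinv.2
    rw [Matrix.smul_mul, Matrix.mul_smul, smul_smul, ← Matrix.map_mul] at h
    ext1 i j
    apply RatFunc.algebraMap_injective C
    have hij := congrFun (congrFun h i) j
    have h1 := toRat_ne_zero C he
    have h2 := toRat_ne_zero C het
    simp only [Matrix.smul_apply, Matrix.map_apply, smul_eq_mul, Matrix.one_apply] at hij ⊢
    rw [← mul_inv, inv_mul_eq_iff_eq_mul₀ (mul_ne_zero h2 h1)] at hij
    rw [hij]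
    split_ifs <;> simp
  -- Elements congruent modulo `Δ A` to an element with denominator `q e ẽ`.
  let P (f : Fin r → RatFunc C) : Prop := ∃ (g : Fin r → RatFunc C) (c : Fin r → Polynomial C),
    f = Dmap C ℓ r g + fracComb C r W (q * e * et) c
  have hadd {f f' : Fin r → RatFunc C} (hf : P f) (hf' : P f') : P (f + f') := by
    obtain ⟨g, c, rfl⟩ := hf
    obtain ⟨g', c', rfl⟩ := hf'
    refine ⟨g + g', c + c', ?_⟩
    rw [Dmap_add, ← fracComb_add]
    abel
  have hofS {f : Fin r → RatFunc C} (hf : P (Smap C ℓ r f)) : P f := by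
    obtain ⟨g, c, hf⟩ := hf
    refine ⟨g + -f, c, ?_⟩
    have h0 : Dmap C ℓ r f + Dmap C ℓ r (-f) = 0 := by
      rw [← Dmap_add, add_neg_cancel]
      simpa [Dmap] using Smap_smul C ℓ r 0 0
    have h1 : f = Smap C ℓ r f - Dmap C ℓ r f := by simp [Dmap]
    rw [Dmap_add, eq_neg_of_add_eq_zero_right h0]
    conv_lhs => rw [h1, hf]
    abel
  have htoS {f : Fin r → RatFunc C} (hf : P f) : P (Smap C ℓ r f) := by
    obtain ⟨g, c, hf⟩ := hf
    refine ⟨g + f, c, ?_⟩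
    rw [Dmap_add, add_right_comm, ← hf]
    simp [Dmap]
  have hdvd {s t : Polynomial C} (hs : t * s = q * e * et) (a : Fin r → Polynomial C) :
      P (fracComb C r W s a) := by
    have ht : t ≠ 0 := left_ne_zero_of_mul (hs ▸ mul_ne_zero (mul_ne_zero hq he) het)
    refine ⟨0, fun i => t * a i, ?_⟩
    rw [← hs, fracComb_mul_left C r W ht]
    have : Dmap C ℓ r 0 = 0 := by simpa [Dmap] using Smap_smul C ℓ r 0 0
    rw [this, zero_add]
  have hmain (k : ℤ) : ∀ a : Fin r → Polynomial C, P (fracComb C r W (polyShift C k q) a) := by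
    induction k using Int.induction_on with
    | zero =>
      intro a
      have h0 : polyShift C 0 q = q := by simp [polyShift, polyShiftEquiv]
      rw [h0]
      exact hdvd (t := e * et) (by ring) a
    | succ n ih =>
      intro a
      have hq1 : (polyσ C).symm (polyShift C (n + 1) q) = polyShift C n q := by
        rw [← polyσ_polyShift, RingEquiv.symm_apply_apply]
      obtain ⟨u, v, huv⟩ := (hcop_e (n + 1)).2
      have huv' := congrArg (polyσ C).symm huv
      rw [map_add, map_mul, map_mul, map_one, hq1] at huv'
      have het' : (polyσ C).symm et ≠ 0 :=
        (map_ne_zero_iff _ (polyσ C).symm.injective).mpr het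
      set b : Fin r → Polynomial C := fun j => (polyσ C).symm (Matrix.vecMul a Mt j) with hb
      have hS : Smap C ℓ r (fracComb C r W (polyShift C n q * (polyσ C).symm et) b) =
          fracComb C r W (polyShift C (n + 1) q) a := by
        rw [Smap_fracComb C ℓ r hSW, map_mul, polyσ_polyShift, RingEquiv.apply_symm_apply]
        simp only [hb, RingEquiv.apply_symm_apply]
        rw [← fracComb_mul_left C r W (mul_ne_zero het he) a]
        have hv : Matrix.vecMul (fun j => Matrix.vecMul a Mt j) M = fun i => et * e * a i := by
          change Matrix.vecMul (Matrix.vecMul a Mt) M = _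
          rw [Matrix.vecMul_vecMul, hMtM, Matrix.vecMul_smul, Matrix.vecMul_one]
          rfl
        rw [hv]
        congr 1
        ring
      rw [← hS]
      apply htoS
      rw [fracComb_partial_fractions C r W (hshift n) het' huv']
      refine hadd (ih _) (hofS ?_)
      rw [Smap_fracComb C ℓ r hSW, RingEquiv.apply_symm_apply]
      exact hdvd (t := q) (by ring) _
    | pred n ih =>
      intro a
      obtain ⟨u, v, huv⟩ := (hcop_e (-n)).1
      apply hofS
      rw [Smap_fracComb C ℓ r hSW, polyσ_polyShift, sub_add_cancel,
        fracComb_partial_fractions C r W (hshift _) he huv]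
      exact hadd (ih _) (hdvd (t := q * et) (by ring) _)
  exact hmain k a

end PRec
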